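/- Let k = r + s ≥ 3 be odd with r ≥ 2, s ≥ 1. Then ζ(r, s̄) = -(1/2)ζ(k̄) + ((1+(-1)^s)/2)ζ(r)ζ(s̄) + (-1)^r Σ_{l=0}^{(k-1)/2} [C(k-2l-1, r-1)ζ(k-2l) + C(k-2l-1, s-1)ζ(overline{k-2l})] ζ(2l̄), with conventions ζ(0) = ζ(0̄) = -1/2. -/

import Mathlib

open Filter Finset Real

/-- `zeta k` : the Riemann zeta value `ζ(k) = Σ_{m≥1} 1/m^k`, with the convention `ζ(0) = -1/2`. -/
noncomputable def zeta (k : ℕ) : ℝ :=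
  if k = 0 then -1/2 else limUnder atTop (fun N => ∑ m ∈ Finset.range N, 1/((m+1 : ℝ))^k)

/-- `zetaA k` : the alternating zeta value `ζ(k̄) = Σ_{m≥1} (-1)^m/m^k`,
with the convention `ζ(0̄) = -1/2`. -/
noncomputable def zetaA (k : ℕ) : ℝ :=
  if k = 0 then -1/2 else
    limUnder atTop (fun N => ∑ m ∈ Finset.range N, (-1 : ℝ)^(m+1)/((m+1 : ℝ))^k)

/-- `dzeta r s = ζ(r,s) = Σ_{m≥2} (1/m^s) Σ_{j=1}^{m-1} 1/j^r`. -/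
noncomputable def dzeta (r s : ℕ) : ℝ :=
  limUnder atTop (fun N => ∑ m ∈ Finset.range N,
    (1/((m+2 : ℝ))^s) * ∑ j ∈ Finset.range (m+1), 1/((j+1 : ℝ))^r)

/-- `dzetaA1 r s = ζ(r̄,s) = Σ_{m≥2} (1/m^s) Σ_{j=1}^{m-1} (-1)^j/j^r`. -/
noncomputable def dzetaA1 (r s : ℕ) : ℝ :=
  limUnder atTop (fun N => ∑ m ∈ Finset.range N,
    (1/((m+2 : ℝ))^s) * ∑ j ∈ Finset.range (m+1), (-1 : ℝ)^(j+1)/((j+1 : ℝ))^r)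

/-- `dzetaA2 r s = ζ(r,s̄) = Σ_{m≥2} ((-1)^m/m^s) Σ_{j=1}^{m-1} 1/j^r`. -/
noncomputable def dzetaA2 (r s : ℕ) : ℝ :=
  limUnder atTop (fun N => ∑ m ∈ Finset.range N,
    ((-1 : ℝ)^(m+2)/((m+2 : ℝ))^s) * ∑ j ∈ Finset.range (m+1), 1/((j+1 : ℝ))^r)

/-- `dzetaA3 r s = ζ(r̄,s̄) = Σ_{m≥2} ((-1)^m/m^s) Σ_{j=1}^{m-1} (-1)^j/j^r`. -/
noncomputable def dzetaA3 (r s : ℕ) : ℝ :=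
  limUnder atTop (fun N => ∑ m ∈ Finset.range N,
    ((-1 : ℝ)^(m+2)/((m+2 : ℝ))^s) * ∑ j ∈ Finset.range (m+1), (-1 : ℝ)^(j+1)/((j+1 : ℝ))^r)

/-- Partial sums of `ζ(p)`. -/
noncomputable def zetaSum (p N : ℕ) : ℝ := ∑ m ∈ range N, 1 / (m + 1 : ℝ) ^ p

/-- Partial sums of the alternating zeta value. -/
noncomputable def zetaASum (p N : ℕ) : ℝ := ∑ m ∈ range N, (-1 : ℝ) ^ (m + 1) / (m + 1 : ℝ) ^ p

lemma zetaSum_succ (p N : ℕ) : zetaSum p (N + 1) = zetaSum p N + 1 / (N + 1 : ℝ) ^ p :=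
  sum_range_succ _ _

lemma zetaASum_succ (p N : ℕ) :
    zetaASum p (N + 1) = zetaASum p N + (-1 : ℝ) ^ (N + 1) / (N + 1 : ℝ) ^ p :=
  sum_range_succ _ _

lemma zetaSum_tendsto_and_error {p : ℕ} (hp : 2 ≤ p) :
    Tendsto (zetaSum p) atTop (nhds (zeta p)) ∧
      ∀ N, |zetaSum p N - zeta p| ≤ 2 / (N + 1 : ℝ) := by
  have hmono : Monotone (zetaSum p) := monotone_nat_of_le_succ fun N => by
    rw [zetaSum_succ]; linarith [show (0 : ℝ) ≤ 1 / (N + 1 : ℝ) ^ p by positivity]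
  have hanti : Antitone fun N : ℕ => zetaSum p N + 2 / (N + 1 : ℝ) :=
    antitone_nat_of_succ_le fun N => by
      have h1 : 1 / (N + 1 : ℝ) ^ p ≤ 1 / (N + 1 : ℝ) ^ 2 :=
        one_div_le_one_div_of_le (by positivity)
          (pow_le_pow_right₀ (by linarith [(Nat.cast_nonneg N : (0 : ℝ) ≤ N)]) hp)
      have h2 : 1 / (N + 1 : ℝ) ^ 2 ≤ 2 / (N + 1 : ℝ) - 2 / (N + 1 + 1 : ℝ) := by
        rw [div_sub_div _ _ (by positivity) (by positivity),
          div_le_div_iff₀ (by positivity) (by positivity)]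
        have : (0 : ℝ) ≤ N := Nat.cast_nonneg N
        nlinarith [mul_nonneg this this, mul_nonneg (mul_nonneg this this) this]
      simp only [zetaSum_succ]
      push_cast
      linarith
  have hbdd : BddAbove (Set.range (zetaSum p)) := by
    refine ⟨zetaSum p 0 + 2 / ((0 : ℕ) + 1 : ℝ), ?_⟩
    rintro _ ⟨N, rfl⟩
    have := hanti (Nat.zero_le N)
    simp only at this
    linarith [show (0 : ℝ) ≤ 2 / (N + 1 : ℝ) by positivity]
  have hlim := tendsto_atTop_ciSup hmono hbdd
  have hz : zeta p = ⨆ i, zetaSum p i := by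
    rw [zeta, if_neg (by omega)]
    exact hlim.limUnder_eq
  rw [← hz] at hlim
  refine ⟨hlim, fun N => ?_⟩
  have hlim' : Tendsto (fun N : ℕ => zetaSum p N + 2 / (N + 1 : ℝ)) atTop (nhds (zeta p)) := by
    simpa [div_eq_mul_inv] using
      hlim.add ((tendsto_one_div_add_atTop_nhds_zero_nat (𝕜 := ℝ)).const_mul 2)
  have h1 := hmono.ge_of_tendsto hlim N
  have h2 := hanti.le_of_tendsto hlim' N
  rw [abs_le]
  constructor <;> linarith [show (0 : ℝ) ≤ 2 / (N + 1 : ℝ) by positivity]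

lemma one_div_pow_le_one_div {p : ℕ} (hp : 1 ≤ p) (N : ℕ) :
    1 / (N + 1 : ℝ) ^ p ≤ 1 / (N + 1 : ℝ) :=
  one_div_le_one_div_of_le (by positivity)
    (le_self_pow₀ (by linarith [(Nat.cast_nonneg N : (0 : ℝ) ≤ N)]) (by omega))

lemma zetaASum_tendsto_and_error {p : ℕ} (hp : 1 ≤ p) :
    Tendsto (zetaASum p) atTop (nhds (zetaA p)) ∧
      ∀ N, |zetaASum p N - zetaA p| ≤ 2 / (N + 1 : ℝ) := by
  have hf : Antitone fun m : ℕ => 1 / (m + 1 : ℝ) ^ p := fun m n hmn =>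
    one_div_le_one_div_of_le (by positivity) (by gcongr)
  have hf0 : Tendsto (fun m : ℕ => 1 / (m + 1 : ℝ) ^ p) atTop (nhds 0) :=
    squeeze_zero (fun m => by positivity) (one_div_pow_le_one_div hp)
      tendsto_one_div_add_atTop_nhds_zero_nat
  have hneg : ∀ N, zetaASum p N = -∑ m ∈ range N, (-1 : ℝ) ^ m * (1 / (m + 1 : ℝ) ^ p) := by
    intro N
    rw [zetaASum, ← sum_neg_distrib]
    exact sum_congr rfl fun m _ => by ring
  obtain ⟨l, hl⟩ := hf.tendsto_alternating_series_of_tendsto_zero hf0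
  have hlim : Tendsto (zetaASum p) atTop (nhds (-l)) := by
    rw [funext hneg]; exact hl.neg
  have hz : zetaA p = -l := by
    rw [zetaA, if_neg (by omega)]
    exact hlim.limUnder_eq
  rw [hz]
  refine ⟨hlim, fun N => ?_⟩
  have key : |zetaASum p N - -l| ≤ 1 / (N + 1 : ℝ) ^ p := by
    rw [hneg, abs_le]
    obtain ⟨q, rfl | rfl⟩ := N.even_or_odd'
    · have h1 := hf.alternating_series_le_tendsto hl q
      have h2 := hf.tendsto_le_alternating_series hl q
      rw [sum_range_succ, pow_mul, neg_one_sq, one_pow, one_mul] at h2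
      have h3 : (0 : ℝ) ≤ 1 / (((2 * q : ℕ) : ℝ) + 1) ^ p := by positivity
      constructor <;> linarith
    · have h1 := hf.alternating_series_le_tendsto hl (q + 1)
      have h2 := hf.tendsto_le_alternating_series hl q
      rw [show 2 * (q + 1) = 2 * q + 1 + 1 by ring, sum_range_succ, pow_succ, pow_mul,
        neg_one_sq, one_pow, one_mul] at h1
      have h3 : (0 : ℝ) ≤ 1 / (((2 * q + 1 : ℕ) : ℝ) + 1) ^ p := by positivity
      constructor <;> linarith
  refine key.trans ((one_div_pow_le_one_div hp N).trans ?_)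
  gcongr
  norm_num

lemma tendsto_sum_one_div_mul_one_div :
    Tendsto (fun N : ℕ => ∑ j ∈ range N, 1 / (j + 1 : ℝ) * (1 / ((N : ℝ) - j)))
      atTop (nhds 0) := by
  have h := (tendsto_one_div_add_atTop_nhds_zero_nat (𝕜 := ℝ)).cesaro.const_mul 2
  rw [mul_zero] at h
  refine squeeze_zero (fun N => sum_nonneg fun j hj => ?_) (fun N => ?_) h
  · have : (j : ℝ) < N := by exact_mod_cast mem_range.1 hj
    have : (0 : ℝ) < N - j := by linarith
    positivity
  · have hsplit : ∀ j ∈ range N, 1 / (j + 1 : ℝ) * (1 / ((N : ℝ) - j)) ≤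
        (N : ℝ)⁻¹ * (1 / (j + 1 : ℝ) + 1 / ((N : ℝ) - j)) := by
      intro j hj
      have h1 : (j : ℝ) < N := by exact_mod_cast mem_range.1 hj
      have h2 : (0 : ℝ) < N - j := by linarith
      have h3 : (0 : ℝ) < N := by linarith [(Nat.cast_nonneg j : (0 : ℝ) ≤ j)]
      have : 1 / (j + 1 : ℝ) + 1 / ((N : ℝ) - j)
          = (N + 1) * (1 / (j + 1 : ℝ) * (1 / ((N : ℝ) - j))) := by
        field_simp; ring
      rw [this, ← mul_assoc]
      refine le_mul_of_one_le_left (by positivity) ?_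
      rw [inv_mul_eq_div, one_le_div h3]
      linarith
    refine (sum_le_sum hsplit).trans (le_of_eq ?_)
    have hrefl : ∑ j ∈ range N, 1 / ((N : ℝ) - j) = ∑ j ∈ range N, 1 / (j + 1 : ℝ) := by
      rw [← sum_range_reflect]
      refine sum_congr rfl fun j hj => ?_
      have : j + 1 ≤ N := mem_range.1 hj
      rw [Nat.sub_sub, Nat.cast_sub (by omega)]
      congr 1
      push_cast
      ring
    rw [← mul_sum, sum_add_distrib, hrefl]
    ring

/-- Moving weights that converge at rate `1 / (N - j)` can be pulled out of the limit. -/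
lemma tendsto_sum_mul_of_error {g : ℕ → ℝ} {f : ℕ → ℕ → ℝ} {G L C : ℝ}
    (hg : ∀ j : ℕ, |g j| ≤ 1 / (j + 1 : ℝ))
    (hG : Tendsto (fun N => ∑ j ∈ range N, g j) atTop (nhds G))
    (hf : ∀ N j : ℕ, j < N → |f N j - L| ≤ C / ((N : ℝ) - j)) :
    Tendsto (fun N => ∑ j ∈ range N, g j * f N j) atTop (nhds (G * L)) := by
  have herr : Tendsto (fun N => ∑ j ∈ range N, g j * (f N j - L)) atTop (nhds 0) := by
    have h := tendsto_sum_one_div_mul_one_div.const_mul C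
    rw [mul_zero] at h
    refine squeeze_zero_norm (fun N => ?_) h
    rw [mul_sum]
    refine (norm_sum_le _ _).trans (sum_le_sum fun j hj => ?_)
    rw [Real.norm_eq_abs, abs_mul]
    refine (mul_le_mul (hg j) (hf N j (mem_range.1 hj)) (abs_nonneg _) (by positivity)).trans
      (le_of_eq (by ring))
  have h := (hG.mul_const L).add herr
  rw [add_zero] at h
  refine h.congr fun N => ?_
  rw [sum_mul, ← sum_add_distrib]
  exact sum_congr rfl fun j _ => by ring

lemma tendsto_zetaASum_conv_sub {q : ℕ} (hq : 1 ≤ q) {F : ℕ → ℝ} {L : ℝ}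
    (hF : ∀ N, |F N - L| ≤ 2 / (N + 1 : ℝ)) :
    Tendsto (fun N => ∑ j ∈ range N, (-1 : ℝ) ^ (j + 1) / (j + 1 : ℝ) ^ q * F (N - 1 - j))
      atTop (nhds (zetaA q * L)) := by
  refine tendsto_sum_mul_of_error (C := 2) (f := fun N j => F (N - 1 - j)) (fun j => ?_)
    (zetaASum_tendsto_and_error hq).1 fun N j hj => ?_
  · rw [abs_div, abs_neg_one_pow, abs_of_nonneg (by positivity)]
    exact one_div_pow_le_one_div hq j
  · refine (hF _).trans (le_of_eq ?_)
    rw [Nat.sub_sub, Nat.cast_sub (by omega)]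
    push_cast
    ring

lemma tendsto_zetaASum_conv_add {q : ℕ} (hq : 1 ≤ q) {F : ℕ → ℝ} {L : ℝ}
    (hF : ∀ N, |F N - L| ≤ 2 / (N + 1 : ℝ)) :
    Tendsto (fun N => ∑ j ∈ range N, (-1 : ℝ) ^ (j + 1) / (j + 1 : ℝ) ^ q * F (N + j + 1))
      atTop (nhds (zetaA q * L)) := by
  refine tendsto_sum_mul_of_error (C := 2) (f := fun N j => F (N + j + 1)) (fun j => ?_)
    (zetaASum_tendsto_and_error hq).1 fun N j hj => ?_
  · rw [abs_div, abs_neg_one_pow, abs_of_nonneg (by positivity)]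
    exact one_div_pow_le_one_div hq j
  · refine (hF _).trans ?_
    have h1 : (j : ℝ) < N := by exact_mod_cast hj
    have h2 : (0 : ℝ) ≤ j := Nat.cast_nonneg j
    refine div_le_div_of_nonneg_left (by norm_num) (by linarith) ?_
    push_cast
    linarith

/-- The part at the pole `x = 0` of the partial fraction expansion of `1 / (x ^ s * (c - x) ^ r)`,
where `r = a + 1` and `r + s = n + 2`. -/
noncomputable def polarPart (n a : ℕ) (x c : ℝ) : ℝ :=
  ∑ i ∈ range (n + 1), ((n - i).choose a : ℝ) / c ^ (n - i + 1) * (1 / x ^ (i + 1))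

lemma polarPart_of_lt {n a : ℕ} (h : n < a) (x c : ℝ) : polarPart n a x c = 0 :=
  sum_eq_zero fun i _ => by rw [Nat.choose_eq_zero_of_lt (by omega)]; simp

lemma mul_polarPart_zero (n : ℕ) (x : ℝ) {c : ℝ} (hc : c ≠ 0) :
    c * polarPart (n + 1) 0 x c = polarPart n 0 x c + 1 / x ^ (n + 2) := by
  rw [polarPart, polarPart, sum_range_succ, mul_add, mul_sum]
  congr 1
  · refine sum_congr rfl fun i hi => ?_
    rw [show n + 1 - i = n - i + 1 by have := mem_range.1 hi; omega]
    simp only [Nat.choose_zero_right, Nat.cast_one]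
    field_simp
    ring
  · simp [hc]

lemma mul_polarPart_succ (n a : ℕ) (x : ℝ) {c : ℝ} (hc : c ≠ 0) :
    c * polarPart (n + 1) (a + 1) x c = polarPart n a x c + polarPart n (a + 1) x c := by
  rw [polarPart, polarPart, polarPart, sum_range_succ, mul_add, mul_sum, ← sum_add_distrib]
  simp only [Nat.sub_self, Nat.choose_zero_succ, Nat.cast_zero, zero_div, zero_mul, mul_zero,
    add_zero]
  refine sum_congr rfl fun i hi => ?_
  rw [show n + 1 - i = n - i + 1 by have := mem_range.1 hi; omega, Nat.choose_succ_succ]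
  push_cast
  field_simp
  ring

/-- Partial fraction expansion of `1 / (x ^ (b + 1) * w ^ (a + 1))` in powers of `x + w`. -/
lemma one_div_mul_eq_polarPart (a b : ℕ) {x w c : ℝ} (hx : x ≠ 0) (hw : w ≠ 0) (hc : c ≠ 0)
    (h : x + w = c) :
    1 / (x ^ (b + 1) * w ^ (a + 1)) = polarPart (a + b) a x c + polarPart (a + b) b w c := by
  have step : ∀ a b : ℕ, c * (1 / (x ^ (b + 1) * w ^ (a + 1))) =
      1 / (x ^ b * w ^ (a + 1)) + 1 / (x ^ (b + 1) * w ^ a) := by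
    intro a b
    rw [← h]
    field_simp
    ring
  apply mul_left_cancel₀ hc
  induction a generalizing b with
  | zero =>
    induction b with
    | zero =>
      rw [step, polarPart, polarPart]
      simp
      field_simp
      ring
    | succ b ih =>
      rw [step, mul_left_cancel₀ hc ih, zero_add, zero_add, mul_add, mul_polarPart_zero _ _ hc,
        mul_polarPart_succ _ _ _ hc, polarPart_of_lt (Nat.lt_succ_self b)]
      ring
  | succ a iha =>
    induction b with
    | zero =>
      rw [step, mul_left_cancel₀ hc (iha 0), add_zero, add_zero, mul_add,
        mul_polarPart_zero _ _ hc, mul_polarPart_succ _ _ _ hc,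
        polarPart_of_lt (Nat.lt_succ_self a)]
      ring
    | succ b ihb =>
      rw [step, mul_left_cancel₀ hc (iha (b + 1)), mul_left_cancel₀ hc ihb,
        show a + 1 + (b + 1) = a + b + 1 + 1 by ring, show a + (b + 1) = a + b + 1 by ring,
        show a + 1 + b = a + b + 1 by ring, mul_add, mul_polarPart_succ _ _ _ hc,
        mul_polarPart_succ _ _ _ hc]
      ring

lemma sum_range_choose_sub (n a : ℕ) :
    ∑ i ∈ range (n + 1), ((n - i).choose a : ℝ) = ((n + 1).choose (a + 1) : ℝ) := by
  have h := sum_range_reflect (fun m => m.choose a) (n + 1)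
  simp only [Nat.add_sub_cancel] at h
  rw [← Nat.cast_sum, h]
  norm_cast
  induction n with
  | zero => cases a <;> simp [Nat.choose_eq_zero_of_lt]
  | succ n ih =>
    rw [sum_range_succ, ih, Nat.choose_succ_succ (n + 1) a, add_comm]
    have h' := sum_range_reflect (fun m => m.choose a) (n + 1)
    simpa using h'

lemma polarPart_self (n a : ℕ) {c : ℝ} (hc : c ≠ 0) :
    polarPart n a c c = ((n + 1).choose (a + 1) : ℝ) / c ^ (n + 2) := by
  rw [← sum_range_choose_sub, sum_div, polarPart]
  refine sum_congr rfl fun i hi => ?_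
  rw [show n + 2 = (n - i + 1) + (i + 1) by have := mem_range.1 hi; omega, pow_add]
  field_simp
  ring

lemma polarPart_zero_left (n a : ℕ) (c : ℝ) : polarPart n a 0 c = 0 := by
  simp [polarPart]

lemma sum_mul_polarPart (N n a : ℕ) (u x : ℕ → ℝ) (c : ℝ) :
    ∑ m ∈ range N, u m * polarPart n a (x m) c =
      ∑ i ∈ range (n + 1), ((n - i).choose a : ℝ) / c ^ (n - i + 1) *
        ∑ m ∈ range N, u m / x m ^ (i + 1) := by
  simp only [polarPart, mul_sum]
  rw [sum_comm]
  exact sum_congr rfl fun i _ => sum_congr rfl fun m _ => by ring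

lemma sum_range_sub_left {N n : ℕ} (hn : n < N) (f : ℝ → ℝ) :
    ∑ m ∈ range N, f ((m : ℝ) - n) =
      ∑ m ∈ range n, f (-(m + 1 : ℝ)) + f 0 + ∑ m ∈ range (N - 1 - n), f (m + 1 : ℝ) := by
  conv_lhs => rw [show N = n + 1 + (N - 1 - n) by omega]
  rw [sum_range_add, sum_range_succ, ← sum_range_reflect]
  congr 1
  · congr 1
    · refine sum_congr rfl fun m hm => ?_
      have : m + 1 ≤ n := mem_range.1 hm
      rw [Nat.sub_sub, Nat.cast_sub (by omega)]
      congr 1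
      push_cast
      ring
    · rw [sub_self]
  · refine sum_congr rfl fun m _ => ?_
    congr 1
    push_cast
    ring

lemma div_neg_pow (t x : ℝ) (p : ℕ) : t / (-x) ^ p = (-1) ^ p * (t / x ^ p) := by
  rcases p.even_or_odd with h | h
  · rw [h.neg_pow, h.neg_one_pow, one_mul]
  · rw [h.neg_pow, h.neg_one_pow, div_neg, neg_one_mul]

lemma sum_one_div_sub_pow {N n r : ℕ} (hn : n < N) (hr : 1 ≤ r) :
    ∑ j ∈ range N, 1 / ((j : ℝ) - n) ^ r =
      (-1) ^ r * zetaSum r n + zetaSum r (N - 1 - n) := by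
  rw [sum_range_sub_left hn (fun t => 1 / t ^ r), zero_pow (by omega), div_zero, add_zero,
    zetaSum, zetaSum, mul_sum]
  congr 1
  refine sum_congr rfl fun m _ => ?_
  rw [div_neg_pow]

lemma sum_neg_one_pow_div_sub_pow {N j p : ℕ} (hj : j < N) (hp : 1 ≤ p) :
    ∑ n ∈ range N, (-1 : ℝ) ^ (n + 1) / ((j : ℝ) - n) ^ p =
      (-1) ^ (j + 1) * (zetaASum p j + (-1) ^ p * zetaASum p (N - 1 - j)) := by
  conv_lhs => rw [show N = j + 1 + (N - 1 - j) by omega]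
  rw [sum_range_add, sum_range_succ, ← sum_range_reflect, sub_self, zero_pow (by omega), div_zero,
    add_zero, zetaASum, zetaASum, mul_add, mul_sum, mul_sum, mul_sum]
  congr 1
  · refine sum_congr rfl fun m hm => ?_
    have hm' : m + 1 ≤ j := mem_range.1 hm
    obtain ⟨t, rfl⟩ := Nat.exists_eq_add_of_le hm'
    rw [show m + 1 + t - 1 - m = t by omega,
      show ((m + 1 + t : ℕ) : ℝ) - t = m + 1 by push_cast; ring, ← mul_div_assoc, ← pow_add,
      show m + 1 + t + 1 + (m + 1) = (t + 1) + 2 * (m + 1) by ring, pow_add _ _ (2 * (m + 1)),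
      pow_mul _ 2, neg_one_sq, one_pow, mul_one]
  · refine sum_congr rfl fun m _ => ?_
    rw [show (j : ℝ) - ((j + 1 + m : ℕ) : ℝ) = -(m + 1 : ℝ) by push_cast; ring, div_neg_pow,
      show j + 1 + m + 1 = (j + 1) + (m + 1) by ring, pow_add _ (j + 1) (m + 1)]
    ring

lemma sum_one_div_add_pow (N n r : ℕ) :
    ∑ j ∈ range N, 1 / ((n : ℝ) + j + 2) ^ r = zetaSum r (N + n + 1) - zetaSum r (n + 1) := by
  rw [zetaSum, zetaSum, show N + n + 1 = n + 1 + N by ring, sum_range_add, add_sub_cancel_left]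
  refine sum_congr rfl fun m _ => ?_
  push_cast
  ring_nf

lemma sum_neg_one_pow_div_add_pow (N j p : ℕ) :
    ∑ n ∈ range N, (-1 : ℝ) ^ (n + 1) / ((n : ℝ) + j + 2) ^ p =
      (-1) ^ (j + 1) * (zetaASum p (N + j + 1) - zetaASum p (j + 1)) := by
  rw [zetaASum, zetaASum, show N + j + 1 = j + 1 + N by ring, sum_range_add, add_sub_cancel_left,
    mul_sum]
  refine sum_congr rfl fun m _ => ?_
  rw [← mul_div_assoc, ← pow_add, show j + 1 + (j + 1 + m + 1) = (m + 1) + 2 * (j + 1) by ring,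
    pow_add _ _ (2 * (j + 1)), pow_mul _ 2, neg_one_sq, one_pow, mul_one]
  push_cast
  ring_nf

/-- The sum of `(-1) ^ x / (x ^ s * (j + 1 - x) ^ r)` over the integers `0 < |x| ≤ N` with
`x ≠ j + 1` (the excluded term is `0` by the convention on division). -/
noncomputable def columnSum (r s N j : ℕ) : ℝ :=
  ∑ n ∈ range N, (-1 : ℝ) ^ (n + 1) * (1 / ((n + 1 : ℝ) ^ s * ((j : ℝ) - n) ^ r)) +
    ∑ n ∈ range N, (-1 : ℝ) ^ (n + 1) * (1 / ((-(n + 1 : ℝ)) ^ s * ((n : ℝ) + j + 2) ^ r))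

lemma columnSum_eq (a b N j : ℕ) (hj : j < N) :
    columnSum (a + 1) (b + 1) N j =
      ∑ i ∈ range (a + b + 1),
        (((a + b - i).choose a : ℝ) * ((1 + (-1) ^ (i + 1)) * zetaASum (i + 1) N) *
            (1 / (j + 1 : ℝ) ^ (a + b - i + 1)) +
          ((a + b - i).choose b : ℝ) * ((-1) ^ (j + 1) / (j + 1 : ℝ) ^ (a + b - i + 1) *
              zetaASum (i + 1) (N + j + 1) +
            (-1) ^ (i + 1) * ((-1) ^ (j + 1) / (j + 1 : ℝ) ^ (a + b - i + 1) *
              zetaASum (i + 1) (N - 1 - j)))) -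
      ((a + b + 1).choose (b + 1) : ℝ) * (1 / (j + 1 : ℝ) ^ (a + b + 2)) -
      ((a + b + 1).choose (a + 1) : ℝ) * ((-1) ^ (j + 1) / (j + 1 : ℝ) ^ (a + b + 2)) := by
  have hc : (j + 1 : ℝ) ≠ 0 := by positivity
  have hpos : ∑ n ∈ range N,
        (-1 : ℝ) ^ (n + 1) * (1 / ((n + 1 : ℝ) ^ (b + 1) * ((j : ℝ) - n) ^ (a + 1))) =
      ∑ n ∈ range N, (-1 : ℝ) ^ (n + 1) * polarPart (a + b) a (n + 1) (j + 1) +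
      ∑ n ∈ range N, (-1 : ℝ) ^ (n + 1) * polarPart (a + b) b (j - n) (j + 1) -
      ((a + b + 1).choose (a + 1) : ℝ) * ((-1) ^ (j + 1) / (j + 1 : ℝ) ^ (a + b + 2)) := by
    rw [← sum_add_distrib, eq_sub_iff_add_eq, ← sum_ite_eq_of_mem (range N) j
      (fun n => ((a + b + 1).choose (a + 1) : ℝ) * ((-1) ^ (n + 1) / (n + 1 : ℝ) ^ (a + b + 2)))
      (mem_range.2 hj), ← sum_add_distrib]
    refine sum_congr rfl fun n _ => ?_
    split_ifs with h
    · subst h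
      rw [sub_self, polarPart_zero_left, polarPart_self _ _ hc, zero_pow (by omega)]
      ring
    · have hw : (j : ℝ) - n ≠ 0 := sub_ne_zero.2 (by exact_mod_cast h)
      rw [one_div_mul_eq_polarPart a b (by positivity) hw hc (by ring)]
      ring
  have hneg : ∑ n ∈ range N,
        (-1 : ℝ) ^ (n + 1) * (1 / ((-(n + 1 : ℝ)) ^ (b + 1) * ((n : ℝ) + j + 2) ^ (a + 1))) =
      ∑ n ∈ range N, (-1 : ℝ) ^ (n + 1) * polarPart (a + b) a (-(n + 1)) (j + 1) +
      ∑ n ∈ range N, (-1 : ℝ) ^ (n + 1) * polarPart (a + b) b (n + j + 2) (j + 1) := by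
    rw [← sum_add_distrib]
    refine sum_congr rfl fun n _ => ?_
    rw [one_div_mul_eq_polarPart a b (neg_ne_zero.2 (by positivity)) (by positivity) hc (by ring)]
    ring
  have hfold : ∀ i, ∑ n ∈ range N, (-1 : ℝ) ^ (n + 1) / (-(n + 1 : ℝ)) ^ (i + 1) =
      (-1) ^ (i + 1) * zetaASum (i + 1) N := by
    intro i
    rw [zetaASum, mul_sum]
    refine sum_congr rfl fun n _ => ?_
    rw [div_neg_pow]
  have hdiag : ((a + b + 1).choose (b + 1) : ℝ) * (1 / (j + 1 : ℝ) ^ (a + b + 2)) =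
      ∑ i ∈ range (a + b + 1), ((a + b - i).choose b : ℝ) / (j + 1 : ℝ) ^ (a + b - i + 1) *
        (1 / (j + 1 : ℝ) ^ (i + 1)) := by
    rw [mul_one_div]
    exact (polarPart_self _ _ hc).symm
  rw [columnSum, hpos, hneg, hdiag]
  simp only [sum_mul_polarPart]
  simp only [hfold, sum_neg_one_pow_div_add_pow,
    sum_neg_one_pow_div_sub_pow hj (Nat.le_add_left _ _), zetaASum_succ]
  rw [sub_eq_add_neg, add_right_comm, ← sub_eq_add_neg, sub_left_inj]
  simp only [← sum_add_distrib, ← sum_sub_distrib]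
  refine sum_congr rfl fun i _ => ?_
  rw [show ∑ n ∈ range N, (-1 : ℝ) ^ (n + 1) / (n + 1 : ℝ) ^ (i + 1) = zetaASum (i + 1) N from rfl]
  have hsq : ((-1 : ℝ) ^ (j + 1)) * (-1) ^ (j + 1) = 1 := by
    rw [← mul_pow]; simp
  linear_combination (-(((a + b - i).choose b : ℝ) / (j + 1 : ℝ) ^ (a + b - i + 1) *
        (1 / (j + 1 : ℝ) ^ (i + 1)))) * hsq

/-- Partial sums of `ζ(r, s̄)`, indexed from `m = 1`. -/
noncomputable def dzetaA2Sum (r s N : ℕ) : ℝ :=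
  ∑ n ∈ range N, (-1 : ℝ) ^ (n + 1) / (n + 1 : ℝ) ^ s * zetaSum r n

lemma sum_columnSum (r s N : ℕ) (hr : 1 ≤ r) :
    ∑ j ∈ range N, columnSum r s N j =
      (-1) ^ r * dzetaA2Sum r s N +
      ∑ n ∈ range N, (-1 : ℝ) ^ (n + 1) / (n + 1 : ℝ) ^ s * zetaSum r (N - 1 - n) +
      (-1) ^ s * (∑ n ∈ range N, (-1 : ℝ) ^ (n + 1) / (n + 1 : ℝ) ^ s * zetaSum r (N + n + 1) -
        dzetaA2Sum r s N - zetaASum (r + s) N) := by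
  simp only [columnSum]
  rw [sum_add_distrib, sum_comm, sum_comm (s := range N) (t := range N)
    (f := fun j n => (-1 : ℝ) ^ (n + 1) * (1 / ((-(n + 1 : ℝ)) ^ s * ((n : ℝ) + j + 2) ^ r)))]
  congr 1
  · rw [dzetaA2Sum, mul_sum, ← sum_add_distrib]
    refine sum_congr rfl fun n hn => ?_
    have h : ∀ j : ℕ, (-1 : ℝ) ^ (n + 1) * (1 / ((n + 1 : ℝ) ^ s * ((j : ℝ) - n) ^ r)) =
        (-1 : ℝ) ^ (n + 1) / (n + 1 : ℝ) ^ s * (1 / ((j : ℝ) - n) ^ r) := fun j => by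
      rw [div_mul_div_comm, mul_one, mul_one_div]
    simp only [h]
    rw [← mul_sum, sum_one_div_sub_pow (mem_range.1 hn) hr]
    ring
  · rw [dzetaA2Sum, zetaASum, ← sum_sub_distrib, ← sum_sub_distrib, mul_sum]
    refine sum_congr rfl fun n _ => ?_
    have h : ∀ j : ℕ,
        (-1 : ℝ) ^ (n + 1) * (1 / ((-(n + 1 : ℝ)) ^ s * ((n : ℝ) + j + 2) ^ r)) =
        (-1) ^ s * ((-1 : ℝ) ^ (n + 1) / (n + 1 : ℝ) ^ s) * (1 / ((n : ℝ) + j + 2) ^ r) :=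
      fun j => by rw [← div_neg_pow, div_mul_div_comm, mul_one, mul_one_div]
    simp only [h]
    rw [← mul_sum, sum_one_div_add_pow, zetaSum_succ r n, pow_add (n + 1 : ℝ) r s]
    field_simp
    ring

lemma tendsto_sum_columnSum (a b : ℕ) (ha : 1 ≤ a) :
    Tendsto (fun N => ∑ j ∈ range N, columnSum (a + 1) (b + 1) N j) atTop
      (nhds (∑ i ∈ range (a + b + 1), (1 + (-1) ^ (i + 1)) * zetaA (i + 1) *
          (((a + b - i).choose a : ℝ) * zeta (a + b - i + 1) +
            ((a + b - i).choose b : ℝ) * zetaA (a + b - i + 1)) -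
        ((a + b + 1).choose (b + 1) : ℝ) * zeta (a + b + 2) -
        ((a + b + 1).choose (a + 1) : ℝ) * zetaA (a + b + 2))) := by
  have hA : ∀ p, Tendsto (zetaASum (p + 1)) atTop (nhds (zetaA (p + 1))) := fun p =>
    (zetaASum_tendsto_and_error (Nat.le_add_left 1 p)).1
  have hE : ∀ p N, |zetaASum (p + 1) N - zetaA (p + 1)| ≤ 2 / (N + 1 : ℝ) := fun p =>
    (zetaASum_tendsto_and_error (Nat.le_add_left 1 p)).2
  have hterm : ∀ i ∈ range (a + b + 1), Tendsto (fun N =>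
      ((a + b - i).choose a : ℝ) * ((1 + (-1) ^ (i + 1)) * zetaASum (i + 1) N) *
          zetaSum (a + b - i + 1) N +
        ((a + b - i).choose b : ℝ) *
          (∑ j ∈ range N, (-1) ^ (j + 1) / (j + 1 : ℝ) ^ (a + b - i + 1) *
              zetaASum (i + 1) (N + j + 1) +
            (-1) ^ (i + 1) * ∑ j ∈ range N, (-1) ^ (j + 1) / (j + 1 : ℝ) ^ (a + b - i + 1) *
              zetaASum (i + 1) (N - 1 - j))) atTop
      (nhds ((1 + (-1) ^ (i + 1)) * zetaA (i + 1) *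
          (((a + b - i).choose a : ℝ) * zeta (a + b - i + 1) +
            ((a + b - i).choose b : ℝ) * zetaA (a + b - i + 1)))) := by
    intro i _
    have h1 : Tendsto (fun N => ((a + b - i).choose a : ℝ) *
        ((1 + (-1) ^ (i + 1)) * zetaASum (i + 1) N) * zetaSum (a + b - i + 1) N) atTop
        (nhds (((a + b - i).choose a : ℝ) * ((1 + (-1) ^ (i + 1)) * zetaA (i + 1)) *
          zeta (a + b - i + 1))) := by
      rcases lt_or_ge (a + b - i) a with h | h
      · simp [Nat.choose_eq_zero_of_lt h]
      · exact (((hA i).const_mul _).const_mul _).mul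
          (zetaSum_tendsto_and_error (by omega)).1
    have h2 := tendsto_zetaASum_conv_add (Nat.le_add_left 1 (a + b - i)) (hE i)
    have h3 := tendsto_zetaASum_conv_sub (Nat.le_add_left 1 (a + b - i)) (hE i)
    refine (h1.add ((h2.add (h3.const_mul ((-1) ^ (i + 1)))).const_mul
      ((a + b - i).choose b : ℝ))).congr' EventuallyEq.rfl |>.trans_eq ?_
    ring_nf
  refine (((tendsto_finsetSum _ hterm).sub
    ((zetaSum_tendsto_and_error (p := a + b + 2) (by omega)).1.const_mul
      ((a + b + 1).choose (b + 1) : ℝ))).sub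
    ((hA (a + b + 1)).const_mul ((a + b + 1).choose (a + 1) : ℝ))).congr fun N => ?_
  rw [sum_congr rfl fun j hj => columnSum_eq a b N j (mem_range.1 hj), sum_sub_distrib,
    sum_sub_distrib, sum_comm, zetaSum, zetaASum, mul_sum, mul_sum]
  congr 2
  refine sum_congr rfl fun i _ => ?_
  rw [sum_add_distrib, ← mul_sum, ← mul_sum, sum_add_distrib, ← mul_sum, zetaSum]

lemma sum_range_one_add_neg_one_pow_mul (q : ℕ) (f : ℕ → ℝ) :
    ∑ i ∈ range (2 * q), (1 + (-1) ^ (i + 1)) * f (i + 1) =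
      2 * ∑ l ∈ range q, f (2 * (l + 1)) := by
  induction q with
  | zero => simp
  | succ q ih =>
    rw [show 2 * (q + 1) = 2 * q + 1 + 1 by ring, sum_range_succ, sum_range_succ, ih,
      sum_range_succ _ q]
    simp only [pow_succ, pow_mul, show 2 * (q + 1) = 2 * q + 1 + 1 by ring]
    ring

lemma dzetaA2_eq_of_tendsto {r s : ℕ} {L : ℝ} (h : Tendsto (dzetaA2Sum r s) atTop (nhds L)) :
    dzetaA2 r s = L := by
  rw [dzetaA2]
  refine Tendsto.limUnder_eq (((tendsto_add_atTop_iff_nat 1).2 h).congr fun N => ?_)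
  rw [dzetaA2Sum, sum_range_succ']
  simp only [zetaSum, range_zero, sum_empty, mul_zero, add_zero]
  refine sum_congr rfl fun m _ => ?_
  push_cast
  ring_nf

theorem dzetaA2_eval (r s k : ℕ) (hr : 2 ≤ r) (hs : 1 ≤ s) (hk : r + s = k)
    (hk3 : 3 ≤ k) (hodd : Odd k) :
    dzetaA2 r s = -(1/2) * zetaA k + ((1 + (-1 : ℝ)^s)/2) * zeta r * zetaA s
      + (-1 : ℝ)^r * ∑ l ∈ Finset.range ((k-1)/2 + 1),
          (((k-2*l-1).choose (r-1) : ℝ) * zeta (k-2*l)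
            + ((k-2*l-1).choose (s-1) : ℝ) * zetaA (k-2*l)) * zetaA (2*l) := by
  obtain ⟨a, rfl⟩ := Nat.exists_eq_add_of_le' (show 1 ≤ r by omega)
  obtain ⟨b, rfl⟩ := Nat.exists_eq_add_of_le' hs
  obtain ⟨q, hq⟩ := hodd
  have hab : a + b + 1 = 2 * q := by omega
  have hk' : k = a + b + 2 := by omega
  have hH := (zetaSum_tendsto_and_error hr).2
  have hlim := ((((tendsto_sum_columnSum a b (by omega)).sub
    (tendsto_zetaASum_conv_sub hs hH)).const_mul ((-1) ^ (a + 1))).add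
    (tendsto_zetaASum_conv_add hs hH)).sub
    (zetaASum_tendsto_and_error (p := a + 1 + (b + 1)) (by omega)).1
  have hsr : (-1 : ℝ) ^ (b + 1) = -(-1) ^ (a + 1) := by
    have h : (-1 : ℝ) ^ (b + 1) * (-1) ^ (a + 1) = -1 := by
      rw [← pow_add, show b + 1 + (a + 1) = 2 * q + 1 by omega, pow_succ, pow_mul]
      simp
    have h' : (-1 : ℝ) ^ (a + 1) * (-1) ^ (a + 1) = 1 := by rw [← mul_pow]; simp
    linear_combination (-1 : ℝ) ^ (a + 1) * h - (-1 : ℝ) ^ (b + 1) * h'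
  have hsq : (-1 : ℝ) ^ (a + 1) * (-1) ^ (a + 1) = 1 := by rw [← mul_pow]; simp
  rw [dzetaA2_eq_of_tendsto ((hlim.const_mul (1 / 2)).congr fun N => ?_)]
  · have hsum : ∑ i ∈ range (a + b + 1), (1 + (-1) ^ (i + 1)) * zetaA (i + 1) *
          (((a + b - i).choose a : ℝ) * zeta (a + b - i + 1) +
            ((a + b - i).choose b : ℝ) * zetaA (a + b - i + 1)) =
        2 * ∑ l ∈ range q, (((k - 2 * (l + 1) - 1).choose a : ℝ) * zeta (k - 2 * (l + 1)) +
            ((k - 2 * (l + 1) - 1).choose b : ℝ) * zetaA (k - 2 * (l + 1))) *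
          zetaA (2 * (l + 1)) := by
      rw [← sum_range_one_add_neg_one_pow_mul q fun i =>
        (((k - i - 1).choose a : ℝ) * zeta (k - i) +
          ((k - i - 1).choose b : ℝ) * zetaA (k - i)) * zetaA i, hab]
      refine sum_congr rfl fun i hi => ?_
      have := mem_range.1 hi
      rw [show k - (i + 1) - 1 = a + b - i by omega, show k - (i + 1) = a + b - i + 1 by omega]
      ring
    rw [hsum, show (k - 1) / 2 + 1 = q + 1 by omega, sum_range_succ', hsr,
      show a + 1 + (b + 1) = k by omega, show a + b + 2 = k by omega]
    have hz : zetaA (2 * 0) = -1 / 2 := by simp [zetaA]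
    have c1 : (a + b + 1).choose (b + 1) = (k - 2 * 0 - 1).choose a := by
      rw [show k - 2 * 0 - 1 = a + b + 1 by omega]
      exact Nat.choose_symm_of_eq_add (by ring)
    have c2 : (a + b + 1).choose (a + 1) = (k - 2 * 0 - 1).choose b := by
      rw [show k - 2 * 0 - 1 = a + b + 1 by omega]
      exact Nat.choose_symm_of_eq_add (by ring)
    rw [hz, c1, c2]
    simp only [Nat.add_sub_cancel, mul_zero, Nat.sub_zero]
    ring
  · rw [sum_columnSum _ _ _ (by omega), hsr]
    linear_combination (dzetaA2Sum (a + 1) (b + 1) N + 1 / 2 * zetaASum (a + 1 + (b + 1)) N -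
      1 / 2 * ∑ n ∈ range N, (-1 : ℝ) ^ (n + 1) / (n + 1 : ℝ) ^ (b + 1) *
        zetaSum (a + 1) (N + n + 1)) * hsq
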